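/- arXiv:2307.13694 — 2 statements merged into one kernel-verified Lean document; each statement's English description precedes it below -/
import Mathlib

section
/- Let B₀ be a bounded subset of the space B(H,K) of bounded linear operators between separable Hilbert spaces H and K. The following are equivalent: (i) B₀ is relatively compact in the strong operator topology; (ii) there is a faithful state σ ∈ S(H) such that { AσA* : A ∈ B₀ } is a relatively compact subset of T_+(K) in trace norm; (iii) there exist an orthonormal basis {φ_i} of H, a probability distribution {p_i} with all p_i > 0, and a sequence {P_m} of finite-rank projections on K such that lim_{m→∞} sup_{A∈B₀} Σ_i p_i ‖(I_K − P_m)Aφ_i‖² = 0. Moreover, if these equivalent properties hold, then { AσA* : A ∈ B₀ } is relatively compact in T_+(K) for every state σ ∈ S(H), and the limit relation in (iii) holds for an arbitrary family {φ_i} of unit vectors in H and any probability distribution {p_i}, provided {P_m} is an increasing sequence of finite-rank projections on K converging strongly to I_K. -/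
open Filter Topology ContinuousLinearMap
open scoped ComplexOrder

noncomputable section

notation "⟪" x ", " y "⟫" => @inner ℂ _ _ x y

section Defs

variable {H K : Type*} [NormedAddCommGroup H] [InnerProductSpace ℂ H] [CompleteSpace H]
  [NormedAddCommGroup K] [InnerProductSpace ℂ K] [CompleteSpace K]

/-- The rank-one operator `|y⟩⟨z|`. -/
def rankOne (y : K) (z : H) : H →L[ℂ] K :=
  (ContinuousLinearMap.toSpanSingleton ℂ y).comp (innerSL ℂ z)

/-- `A` is a trace-class operator (equivalently, nuclear operator). -/
def IsTC (A : H →L[ℂ] K) : Prop :=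
  ∃ f : ℕ → K, ∃ g : ℕ → H, Summable (fun n => ‖f n‖ * ‖g n‖) ∧
    ∀ x : H, HasSum (fun n => ⟪g n, x⟫ • f n) (A x)

/-- The trace of an operator, computed in a Hilbert basis. -/
def trC {ι : Type*} (e : HilbertBasis ι ℂ H) (A : H →L[ℂ] H) : ℂ :=
  ∑' i, ⟪e i, A (e i)⟫

/-- The trace norm `‖A‖₁ = sup {|Tr (B A)| : ‖B‖ ≤ 1}`. -/
def tnorm {ι : Type*} (e : HilbertBasis ι ℂ H) (A : H →L[ℂ] H) : ℝ :=
  sSup { r : ℝ | ∃ B : H →L[ℂ] H, ‖B‖ ≤ 1 ∧ r = ‖trC e (B ∘L A)‖ }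

/-- Membership in the positive cone `T₊(H)` of trace-class operators. -/
def IsPTC (ρ : H →L[ℂ] H) : Prop := ρ.IsPositive ∧ IsTC ρ

/-- `ρ` is a state (a positive trace-class operator of unit trace). -/
def IsState {ι : Type*} (e : HilbertBasis ι ℂ H) (ρ : H →L[ℂ] H) : Prop :=
  ρ.IsPositive ∧ IsTC ρ ∧ trC e ρ = 1

/-- `ρ` is a faithful state (a state with trivial kernel). -/
def IsFaithfulState {ι : Type*} (e : HilbertBasis ι ℂ H) (ρ : H →L[ℂ] H) : Prop :=
  IsState e ρ ∧ ∀ x, ρ x = 0 → x = 0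

/-- The Loewner operator order. -/
def OpLE (A B : H →L[ℂ] H) : Prop := (B - A).IsPositive

/-- `S` is the least upper bound of the sequence `A` in the Loewner order. -/
def IsLUBOp (A : ℕ → H →L[ℂ] H) (S : H →L[ℂ] H) : Prop :=
  (∀ m, OpLE (A m) S) ∧ ∀ C, (∀ m, OpLE (A m) C) → OpLE S C

/-- A quantum operation from `A` to `B`: a completely positive trace-non-increasing
linear map from `T(H_A)` to `T(H_B)`. -/
structure QOp (eA : HilbertBasis ℕ ℂ H) (eB : HilbertBasis ℕ ℂ K) where
  toFun : (H →L[ℂ] H) → (K →L[ℂ] K)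
  map_add' : ∀ ρ σ : H →L[ℂ] H, IsTC ρ → IsTC σ → toFun (ρ + σ) = toFun ρ + toFun σ
  map_smul' : ∀ (c : ℂ) (ρ : H →L[ℂ] H), IsTC ρ → toFun (c • ρ) = c • toFun ρ
  maps_tc' : ∀ ρ : H →L[ℂ] H, IsTC ρ → IsTC (toFun ρ)
  completely_pos' : ∀ (n : ℕ) (y : Fin n → H) (x : Fin n → K),
    0 ≤ ∑ i, ∑ j, ⟪x i, toFun (rankOne (y i) (y j)) (x j)⟫
  trace_nonincreasing' : ∀ ρ : H →L[ℂ] H, ρ.IsPositive → IsTC ρ →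
    (trC eB (toFun ρ)).re ≤ (trC eA ρ).re

variable {eA : HilbertBasis ℕ ℂ H} {eB : HilbertBasis ℕ ℂ K}

/-- A quantum channel is a trace-preserving quantum operation. -/
def IsChannel (Φ : QOp eA eB) : Prop :=
  ∀ ρ : H →L[ℂ] H, ρ.IsPositive → IsTC ρ → trC eB (Φ.toFun ρ) = trC eA ρ

/-- Convergence in the trace norm. -/
def TNConv {ι : Type*} (e : HilbertBasis ι ℂ K) (a : ℕ → K →L[ℂ] K) (L : K →L[ℂ] K) : Prop :=
  Tendsto (fun n => tnorm e (a n - L)) atTop (nhds 0)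

/-- Strong convergence of a sequence of quantum operations. -/
def StrongConv (Φn : ℕ → QOp eA eB) (Φ : QOp eA eB) : Prop :=
  ∀ ρ : H →L[ℂ] H, IsState eA ρ → TNConv eB (fun n => (Φn n).toFun ρ) (Φ.toFun ρ)

/-- Relative (sequential) compactness in the strong convergence topology. -/
def QRelCompact (F : Set (QOp eA eB)) : Prop :=
  ∀ Φs : ℕ → QOp eA eB, (∀ n, Φs n ∈ F) →
    ∃ (k : ℕ → ℕ) (Φ₀ : QOp eA eB), StrictMono k ∧ StrongConv (fun n => Φs (k n)) Φ₀

/-- Relative (sequential) compactness within the set of quantum channels. -/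
def QRelCompactCh (F : Set (QOp eA eB)) : Prop :=
  ∀ Φs : ℕ → QOp eA eB, (∀ n, Φs n ∈ F) →
    ∃ (k : ℕ → ℕ) (Φ₀ : QOp eA eB), StrictMono k ∧ IsChannel Φ₀ ∧
      StrongConv (fun n => Φs (k n)) Φ₀

/-- (Sequential) compactness in the strong convergence topology. -/
def QSeqCompact (F : Set (QOp eA eB)) : Prop :=
  ∀ Φs : ℕ → QOp eA eB, (∀ n, Φs n ∈ F) →
    ∃ (k : ℕ → ℕ) (Φ₀ : QOp eA eB), StrictMono k ∧ Φ₀ ∈ F ∧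
      StrongConv (fun n => Φs (k n)) Φ₀

/-- (Sequential) closedness in the strong convergence topology. -/
def QSeqClosed (F : Set (QOp eA eB)) : Prop :=
  ∀ (Φs : ℕ → QOp eA eB) (Φ₀ : QOp eA eB), (∀ n, Φs n ∈ F) → StrongConv Φs Φ₀ → Φ₀ ∈ F

/-- (Sequential) compactness of a set of operators in the trace norm. -/
def TNSeqCompact {ι : Type*} (e : HilbertBasis ι ℂ K) (S : Set (K →L[ℂ] K)) : Prop :=
  ∀ a : ℕ → K →L[ℂ] K, (∀ n, a n ∈ S) →
    ∃ (k : ℕ → ℕ) (L : K →L[ℂ] K), StrictMono k ∧ L ∈ S ∧ TNConv e (fun n => a (k n)) L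

/-- Relative (sequential) compactness of `S` within the ambient set `T`, in the trace norm. -/
def TNRelCompactIn {ι : Type*} (e : HilbertBasis ι ℂ K) (T S : Set (K →L[ℂ] K)) : Prop :=
  ∀ a : ℕ → K →L[ℂ] K, (∀ n, a n ∈ S) →
    ∃ (k : ℕ → ℕ) (L : K →L[ℂ] K), StrictMono k ∧ L ∈ T ∧ TNConv e (fun n => a (k n)) L

/-- `A` is a Kraus representation of `Φ`. -/
def KrausRep (Φ : QOp eA eB) (A : ℕ → H →L[ℂ] K) : Prop :=
  ∀ ρ : H →L[ℂ] H, IsTC ρ →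
    HasSum (fun n => A n ∘L ρ ∘L (ContinuousLinearMap.adjoint (A n))) (Φ.toFun ρ)

/-- The Choi rank of a quantum operation: the minimal number of Kraus operators. -/
def ChoiRank (Φ : QOp eA eB) : ℕ∞ :=
  sInf { n : ℕ∞ | ∃ A : ℕ → H →L[ℂ] K, (∀ i : ℕ, n ≤ (i : ℕ∞) → A i = 0) ∧ KrausRep Φ A }

/-- Convergence in the strong operator topology. -/
def SOTConv (a : ℕ → H →L[ℂ] K) (A : H →L[ℂ] K) : Prop :=
  ∀ x : H, Tendsto (fun n => a n x) atTop (nhds (A x))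

/-- Relative (sequential) compactness in the strong operator topology. -/
def SOTRelCompact (S : Set (H →L[ℂ] K)) : Prop :=
  ∀ a : ℕ → H →L[ℂ] K, (∀ n, a n ∈ S) →
    ∃ (k : ℕ → ℕ) (A : H →L[ℂ] K), StrictMono k ∧ SOTConv (fun n => a (k n)) A

/-- (Sequential) compactness in the strong operator topology. -/
def SOTSeqCompact (S : Set (H →L[ℂ] K)) : Prop :=
  ∀ a : ℕ → H →L[ℂ] K, (∀ n, a n ∈ S) →
    ∃ (k : ℕ → ℕ) (A : H →L[ℂ] K), StrictMono k ∧ A ∈ S ∧ SOTConv (fun n => a (k n)) A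

/-- A finite-rank orthogonal projection. -/
def IsFinRankProj (P : K →L[ℂ] K) : Prop :=
  IsSelfAdjoint P ∧ P ∘L P = P ∧ FiniteDimensional ℂ (LinearMap.range (P : K →ₗ[ℂ] K))

end Defs

section Tensor

variable {H K W : Type*} [NormedAddCommGroup H] [InnerProductSpace ℂ H] [CompleteSpace H]
  [NormedAddCommGroup K] [InnerProductSpace ℂ K] [CompleteSpace K]
  [NormedAddCommGroup W] [InnerProductSpace ℂ W] [CompleteSpace W]

/-- A realization of `W` as the Hilbert tensor product `H ⊗ K`. -/
structure TensorStruct (H K W : Type*) [NormedAddCommGroup H] [InnerProductSpace ℂ H]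
    [NormedAddCommGroup K] [InnerProductSpace ℂ K]
    [NormedAddCommGroup W] [InnerProductSpace ℂ W] where
  mul : H → K → W
  inner_mul : ∀ (x x' : H) (y y' : K), ⟪mul x y, mul x' y'⟫ = ⟪x, x'⟫ * ⟪y, y'⟫
  dense_span : Dense (↑(Submodule.span ℂ {w : W | ∃ x y, w = mul x y}) : Set W)

/-- `Z = X ⊗ Y` relative to the tensor realization `T`. -/
def IsTensorOp (T : TensorStruct H K W) (X : H →L[ℂ] H) (Y : K →L[ℂ] K)
    (Z : W →L[ℂ] W) : Prop :=
  ∀ x y, Z (T.mul x y) = T.mul (X x) (Y y)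

/-- `b = Tr_K ω`, the left partial trace, characterized by duality. -/
def IsLeftMarginal (T : TensorStruct H K W) {ι κ : Type*} (eH : HilbertBasis ι ℂ H)
    (eW : HilbertBasis κ ℂ W) (ω : W →L[ℂ] W) (b : H →L[ℂ] H) : Prop :=
  ∀ (X : H →L[ℂ] H) (Z : W →L[ℂ] W), IsTensorOp T X 1 Z →
    trC eH (b ∘L X) = trC eW (ω ∘L Z)

/-- `c = Tr_H ω`, the right partial trace, characterized by duality. -/
def IsRightMarginal (T : TensorStruct H K W) {ι κ : Type*} (eK : HilbertBasis ι ℂ K)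
    (eW : HilbertBasis κ ℂ W) (ω : W →L[ℂ] W) (c : K →L[ℂ] K) : Prop :=
  ∀ (Y : K →L[ℂ] K) (Z : W →L[ℂ] W), IsTensorOp T 1 Y Z →
    trC eK (c ∘L Y) = trC eW (ω ∘L Z)

end Tensor

section Auxiliary

variable {H K : Type*} [NormedAddCommGroup H] [InnerProductSpace ℂ H]
  [NormedAddCommGroup K] [InnerProductSpace ℂ K]

theorem totallyBounded_of_forall_seq {X : Type*} [UniformSpace X] {s : Set X}
    (h : ∀ u : ℕ → X, (∀ n, u n ∈ s) →
      ∃ (k : ℕ → ℕ) (x : X), StrictMono k ∧ Tendsto (fun n => u (k n)) atTop (𝓝 x)) :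
    TotallyBounded s := by
  intro V V_in
  contrapose! h
  obtain ⟨u, u_in, hu⟩ : ∃ u : ℕ → X, (∀ n, u n ∈ s) ∧
      ∀ n m, m < n → u m ∉ UniformSpace.ball (u n) V := by
    simp only [Set.not_subset, Set.mem_iUnion₂, not_exists, exists_prop] at h
    simpa only [forall_and, Set.forall_mem_image, not_and] using! Set.seq_of_forall_finite_exists h
  refine ⟨u, u_in, fun φ x hφ huφ => ?_⟩
  obtain ⟨N, hN⟩ : ∃ N, ∀ p q, p ≥ N → q ≥ N → (u (φ p), u (φ q)) ∈ V :=
    huφ.cauchySeq.mem_entourage V_in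
  exact hu (φ <| N + 1) (φ N) (hφ <| Nat.lt_add_one N) (hN (N + 1) N N.le_succ le_rfl)

/-- Contractions tending to zero pointwise on a totally bounded set do so uniformly. -/
theorem TotallyBounded.eventually_norm_le {E F : Type*} [NormedAddCommGroup E]
    [NormedAddCommGroup F] {M : Set E} (hM : TotallyBounded M) {T : ℕ → E → F}
    (hT : ∀ m x y, ‖T m x - T m y‖ ≤ ‖x - y‖)
    (hT0 : ∀ x ∈ M, Tendsto (fun m => T m x) atTop (𝓝 0)) {ε : ℝ} (hε : 0 < ε) :
    ∀ᶠ m in atTop, ∀ x ∈ M, ‖T m x‖ ≤ ε := by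
  obtain ⟨t, htM, htf, ht⟩ := totallyBounded_iff_subset.1 hM _
    (Metric.dist_mem_uniformity (half_pos hε))
  have h1 : ∀ᶠ m in atTop, ∀ y ∈ t, ‖T m y‖ < ε / 2 := by
    rw [htf.eventually_all]
    intro y hy
    have := (hT0 y (htM hy)).norm
    rw [norm_zero] at this
    exact this.eventually_lt_const (half_pos hε)
  filter_upwards [h1] with m hm x hx
  obtain ⟨y, hy, hxy⟩ := Set.mem_iUnion₂.1 (ht hx)
  have h2 : dist x y < ε / 2 := hxy
  rw [dist_eq_norm] at h2
  calc ‖T m x‖ = ‖(T m x - T m y) + T m y‖ := by rw [sub_add_cancel]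
    _ ≤ ‖T m x - T m y‖ + ‖T m y‖ := norm_add_le _ _
    _ ≤ ε := by linarith [hT m x y, hm y hy]

/-- A bounded set uniformly approximated by finite-rank operators is totally bounded. -/
theorem totallyBounded_of_finiteRank_approx {M : Set K} (hM : Bornology.IsBounded M)
    (h : ∀ ε > 0, ∃ P : K →L[ℂ] K,
      FiniteDimensional ℂ (LinearMap.range (P : K →ₗ[ℂ] K)) ∧ ∀ x ∈ M, ‖x - P x‖ ≤ ε) :
    TotallyBounded M := by
  rw [Metric.totallyBounded_iff]
  intro ε hε
  obtain ⟨P, hP, hPM⟩ := h (ε / 3) (by positivity)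
  have hPb : TotallyBounded (P '' M) := by
    obtain ⟨R, hR⟩ := (P.lipschitz.isBounded_image hM).exists_norm_le
    have hc : IsCompact ((Subtype.val : LinearMap.range (P : K →ₗ[ℂ] K) → K) ''
        Metric.closedBall 0 R) := by
      have : ProperSpace (LinearMap.range (P : K →ₗ[ℂ] K)) := FiniteDimensional.proper ℂ _
      exact (isCompact_closedBall _ _).image continuous_subtype_val
    refine hc.totallyBounded.subset ?_
    rintro _ ⟨x, hx, rfl⟩
    refine ⟨⟨P x, ⟨x, rfl⟩⟩, ?_, rfl⟩
    rw [mem_closedBall_zero_iff]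
    exact hR _ ⟨x, hx, rfl⟩
  obtain ⟨t, htM, htf, ht⟩ := totallyBounded_iff_subset.1 hPb _
    (Metric.dist_mem_uniformity (show 0 < ε / 3 by positivity))
  refine ⟨t, htf, fun x hx => ?_⟩
  obtain ⟨y, hy, hxy⟩ := Set.mem_iUnion₂.1 (ht ⟨x, hx, rfl⟩)
  have h2 : dist (P x) y < ε / 3 := hxy
  refine Set.mem_iUnion₂.2 ⟨y, hy, ?_⟩
  have h3 := hPM x hx
  rw [← dist_eq_norm] at h3
  rw [Metric.mem_ball]
  linarith [dist_triangle x (P x) y]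

theorem SOTRelCompact.totallyBounded {B₀ : Set (H →L[ℂ] K)} (h : SOTRelCompact B₀) (x : H) :
    TotallyBounded ((fun A : H →L[ℂ] K => A x) '' B₀) := by
  refine totallyBounded_of_forall_seq fun u hu => ?_
  choose a ha hau using hu
  obtain ⟨k, A, hk, hA⟩ := h a ha
  exact ⟨k, A x, hk, by simpa only [← hau] using hA x⟩

theorem HilbertBasis.dense_span_range {ι : Type*} (e : HilbertBasis ι ℂ H) :
    Dense (Submodule.span ℂ (Set.range e) : Set H) := by
  rw [Submodule.dense_iff_topologicalClosure_eq_top]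
  exact e.dense_span

/-- `T = ∑ₙ |fₙ⟩⟨gₙ|` is a nuclear representation of `T`. -/
def IsNuclearRep {κ : Type*} (T : H →L[ℂ] K) (f : κ → K) (g : κ → H) : Prop :=
  Summable (fun n => ‖f n‖ * ‖g n‖) ∧ ∀ x : H, HasSum (fun n => ⟪g n, x⟫ • f n) (T x)

namespace IsNuclearRep

variable {κ κ' : Type*}

theorem norm_le {T : H →L[ℂ] K} {f : κ → K} {g : κ → H} (h : IsNuclearRep T f g) :
    ‖T‖ ≤ ∑' n, ‖f n‖ * ‖g n‖ := by
  refine T.opNorm_le_bound (tsum_nonneg fun n => by positivity) fun x => ?_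
  rw [← tsum_mul_right, ← (h.2 x).tsum_eq]
  refine tsum_of_norm_bounded (h.1.mul_right ‖x‖).hasSum fun n => ?_
  rw [norm_smul]
  calc ‖⟪g n, x⟫‖ * ‖f n‖ ≤ (‖g n‖ * ‖x‖) * ‖f n‖ := by
        gcongr
        exact norm_inner_le_norm _ _
    _ = ‖f n‖ * ‖g n‖ * ‖x‖ := by ring

theorem comp_left {L : Type*} [NormedAddCommGroup L] [InnerProductSpace ℂ L]
    {T : H →L[ℂ] K} {f : κ → K} {g : κ → H}
    (h : IsNuclearRep T f g) (B : K →L[ℂ] L) : IsNuclearRep (B ∘L T) (fun n => B (f n)) g := by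
  refine ⟨(h.1.mul_left ‖B‖).of_nonneg_of_le (fun n => by positivity) fun n => ?_, fun x => ?_⟩
  · rw [← mul_assoc]
    gcongr
    exact B.le_opNorm _
  · simpa using (h.2 x).mapL B

theorem comp_adjoint [CompleteSpace H] {L : Type*} [NormedAddCommGroup L] [InnerProductSpace ℂ L] [CompleteSpace L]
    {T : H →L[ℂ] K} {f : κ → K} {g : κ → H}
    (h : IsNuclearRep T f g) (A : H →L[ℂ] L) :
    IsNuclearRep (T ∘L adjoint A) f (fun n => A (g n)) := by
  refine ⟨(h.1.mul_left ‖A‖).of_nonneg_of_le (fun n => by positivity) fun n => ?_, fun x => ?_⟩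
  · rw [mul_left_comm]
    gcongr
    exact A.le_opNorm _
  · simpa [adjoint_inner_right] using h.2 (adjoint A x)

theorem sub {T S : H →L[ℂ] K} {f : κ → K} {g : κ → H} {f' : κ' → K} {g' : κ' → H}
    (h : IsNuclearRep T f g) (h' : IsNuclearRep S f' g') :
    IsNuclearRep (T - S) (Sum.elim f fun n => -f' n) (Sum.elim g g') := by
  refine ⟨?_, fun x => ?_⟩
  · exact (HasSum.sum (f := fun n : κ ⊕ κ' =>
      ‖Sum.elim f (fun n => -f' n) n‖ * ‖Sum.elim g g' n‖) (by exact h.1.hasSum)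
      (b := ∑' n, ‖f' n‖ * ‖g' n‖) (by
        simpa [Function.comp_def] using h'.1.hasSum)).summable
  · rw [sub_apply, sub_eq_add_neg]
    refine HasSum.sum (by exact h.2 x) ?_
    simpa [Function.comp_def] using (h'.2 x).neg

theorem norm_trC_le {ι : Type*} (e : HilbertBasis ι ℂ H) {T : H →L[ℂ] H} {f g : κ → H}
    (h : IsNuclearRep T f g) : ‖trC e T‖ ≤ ∑' n, ‖f n‖ * ‖g n‖ := by
  have hsum : ∀ n, Summable fun i => ‖⟪g n, e i⟫ * ⟪e i, f n⟫‖ := fun n =>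
    (e.summable_inner_mul_inner (g n) (f n)).norm
  have hle : ∀ n, ∑' i, ‖⟪g n, e i⟫ * ⟪e i, f n⟫‖ ≤ ‖f n‖ * ‖g n‖ := by
    intro n
    have h1 : Summable fun i => ‖⟪e i, g n⟫‖ ^ 2 := e.orthonormal.inner_products_summable _
    have h2 : Summable fun i => ‖⟪e i, f n⟫‖ ^ 2 := e.orthonormal.inner_products_summable _
    have h1' : ∑' i, ‖⟪e i, g n⟫‖ ^ 2 ≤ ‖g n‖ ^ 2 := e.orthonormal.tsum_inner_products_le _
    have h2' : ∑' i, ‖⟪e i, f n⟫‖ ^ 2 ≤ ‖f n‖ ^ 2 := e.orthonormal.tsum_inner_products_le _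
    have h3 := (Real.inner_le_Lp_mul_Lq_tsum_of_nonneg (p := 2) (q := 2)
      (f := fun i => ‖⟪e i, g n⟫‖) (g := fun i => ‖⟪e i, f n⟫‖) Real.HolderConjugate.two_two
      (fun i => norm_nonneg _) (fun i => norm_nonneg _)
      (by simpa using h1) (by simpa using h2))
    simp only [norm_mul, norm_inner_symm (g n)]
    refine h3.trans ?_
    rw [mul_comm]
    simp only [Real.rpow_two, ← Real.sqrt_eq_rpow]
    gcongr
    · exact Real.sqrt_le_iff.2 ⟨norm_nonneg _, h2'⟩
    · exact Real.sqrt_le_iff.2 ⟨norm_nonneg _, h1'⟩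
  have hprod : Summable fun q : κ × ι => ‖⟪g q.1, e q.2⟫ * ⟪e q.2, f q.1⟫‖ := by
    rw [summable_prod_of_nonneg fun q => norm_nonneg _]
    exact ⟨hsum, h.1.of_nonneg_of_le (fun n => tsum_nonneg fun i => norm_nonneg _) hle⟩
  have htr : trC e T = ∑' n, ∑' i, ⟪g n, e i⟫ * ⟪e i, f n⟫ := by
    rw [Summable.tsum_comm (f := fun i n => ⟪g n, e i⟫ * ⟪e i, f n⟫) ?_]
    · refine tsum_congr fun i => ?_
      have := ((h.2 (e i)).mapL (innerSL ℂ (e i))).tsum_eq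
      simpa [inner_smul_right] using this.symm
    · exact hprod.of_norm.prod_symm
  rw [htr]
  exact tsum_of_norm_bounded h.1.hasSum fun n =>
    (norm_tsum_le_tsum_norm (hsum n)).trans (hle n)

theorem norm_trC_comp_le {ι : Type*} (e : HilbertBasis ι ℂ H) {T : H →L[ℂ] H} {f g : κ → H}
    (h : IsNuclearRep T f g) {B : H →L[ℂ] H} (hB : ‖B‖ ≤ 1) :
    ‖trC e (B ∘L T)‖ ≤ ∑' n, ‖f n‖ * ‖g n‖ := by
  refine ((h.comp_left B).norm_trC_le e).trans ?_
  refine (h.comp_left B).1.tsum_le_tsum (fun n => ?_) h.1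
  gcongr
  simpa using B.le_of_opNorm_le hB (f n)

theorem tnorm_le {ι : Type*} (e : HilbertBasis ι ℂ H) {T : H →L[ℂ] H} {f g : κ → H}
    (h : IsNuclearRep T f g) : tnorm e T ≤ ∑' n, ‖f n‖ * ‖g n‖ := by
  refine csSup_le ⟨_, 0, by simp, rfl⟩ ?_
  rintro _ ⟨B, hB, rfl⟩
  exact h.norm_trC_comp_le e hB

theorem norm_le_tnorm [CompleteSpace H] {ι : Type*} (e : HilbertBasis ι ℂ H) {T : H →L[ℂ] H} {f g : κ → H}
    (h : IsNuclearRep T f g) : ‖T‖ ≤ tnorm e T := by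
  have hbdd : BddAbove {r : ℝ | ∃ B : H →L[ℂ] H, ‖B‖ ≤ 1 ∧ r = ‖trC e (B ∘L T)‖} := by
    refine ⟨∑' n, ‖f n‖ * ‖g n‖, ?_⟩
    rintro _ ⟨B, hB, rfl⟩
    exact h.norm_trC_comp_le e hB
  have hnn : 0 ≤ tnorm e T := le_csSup hbdd ⟨0, by simp, by simp [trC]⟩
  refine T.opNorm_le_of_unit_norm hnn fun x hx => ?_
  refine le_csSup hbdd ⟨((‖T x‖ : ℂ)⁻¹) • rankOne x (T x), ?_, ?_⟩
  · refine opNorm_le_bound _ zero_le_one fun y => ?_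
    have h1 : ‖⟪T x, y⟫‖ ≤ ‖T x‖ * ‖y‖ := norm_inner_le_norm _ _
    have h2 : ‖T x‖⁻¹ * ‖⟪T x, y⟫‖ ≤ ‖y‖ := by
      calc ‖T x‖⁻¹ * ‖⟪T x, y⟫‖ ≤ ‖T x‖⁻¹ * (‖T x‖ * ‖y‖) := by gcongr
        _ = (‖T x‖⁻¹ * ‖T x‖) * ‖y‖ := by ring
        _ ≤ 1 * ‖y‖ := by
          gcongr
          exact inv_mul_le_one
        _ = ‖y‖ := one_mul _
    simpa [rankOne, norm_smul, hx] using h2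
  · have h1 : ∀ i, ⟪e i, (((‖T x‖ : ℂ)⁻¹ • rankOne x (T x)) ∘L T) (e i)⟫ =
        (‖T x‖ : ℂ)⁻¹ * (⟪adjoint T (T x), e i⟫ * ⟪e i, x⟫) := by
      intro i
      simp [rankOne, adjoint_inner_left]
    simp only [trC, h1]
    rw [tsum_mul_left, e.tsum_inner_mul_inner, adjoint_inner_left, inner_self_eq_norm_sq_to_K]
    by_cases h0 : ‖T x‖ = 0
    · simp [h0]
    · simp [sq, h0]

end IsNuclearRep

theorem tnorm_nonneg {ι : Type*} (e : HilbertBasis ι ℂ H) (T : H →L[ℂ] H) : 0 ≤ tnorm e T := by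
  refine Real.sSup_nonneg ?_
  rintro _ ⟨B, -, rfl⟩
  exact norm_nonneg _

theorem IsTC.tendsto_norm_comp {T : H →L[ℂ] K} (hT : IsTC T) {Q : ℕ → K →L[ℂ] K}
    (hQ : ∀ m, ‖Q m‖ ≤ 1) (hQ0 : ∀ x, Tendsto (fun m => Q m x) atTop (𝓝 0)) :
    Tendsto (fun m => Q m ∘L T) atTop (𝓝 0) := by
  obtain ⟨f, g, h⟩ : ∃ (f : ℕ → K) (g : ℕ → H), IsNuclearRep T f g := hT
  have := tendsto_tsum_of_dominated_convergence (𝓕 := atTop)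
    (f := fun m n => ‖Q m (f n)‖ * ‖g n‖) (g := fun _ => (0 : ℝ)) h.1
    (fun n => by simpa using (hQ0 (f n)).norm.mul_const ‖g n‖)
    (Eventually.of_forall fun m n => by
      rw [Real.norm_of_nonneg (by positivity)]
      gcongr
      simpa using (Q m).le_of_opNorm_le (hQ m) (f n))
  rw [tsum_zero] at this
  exact squeeze_zero_norm (fun m => (h.comp_left (Q m)).norm_le) this

variable [CompleteSpace K]

theorem IsFinRankProj.norm_one_sub_le {P : K →L[ℂ] K} (hP : IsFinRankProj P) :
    ‖(1 : K →L[ℂ] K) - P‖ ≤ 1 :=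
  IsStarProjection.norm_le _ (IsStarProjection.one_sub ⟨hP.2.1, hP.1⟩)

theorem HilbertBasis.exists_isFinRankProj_tendsto (e : HilbertBasis ℕ ℂ K) :
    ∃ P : ℕ → K →L[ℂ] K, (∀ m, IsFinRankProj (P m)) ∧ (∀ m, P (m + 1) ∘L P m = P m) ∧
      ∀ x : K, Tendsto (fun m => P m x) atTop (𝓝 x) := by
  let U : ℕ → Submodule ℂ K := fun m => Submodule.span ℂ (e '' Set.Iio m)
  have hfin : ∀ m, FiniteDimensional ℂ (U m) := fun m =>
    FiniteDimensional.span_of_finite ℂ ((Set.finite_Iio m).image _)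
  have hU : Monotone U := fun m n hmn =>
    Submodule.span_mono (Set.image_mono (Set.Iio_subset_Iio hmn))
  refine ⟨fun m => (U m).starProjection, fun m => ?_, fun m => ?_, fun x => ?_⟩
  · have h := isStarProjection_starProjection (U := U m)
    refine ⟨h.isSelfAdjoint, h.isIdempotentElem, ?_⟩
    rw [Submodule.range_starProjection]
    exact hfin m
  · ext x
    exact Submodule.starProjection_eq_self_iff.2
      (hU m.le_succ (Submodule.starProjection_apply_mem _ _))
  · refine Submodule.starProjection_tendsto_self U hU x ?_
    rw [← e.dense_span]
    refine Submodule.topologicalClosure_mono (Submodule.span_le.2 ?_)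
    rintro _ ⟨i, rfl⟩
    exact Submodule.mem_iSup_of_mem (i + 1)
      (Submodule.subset_span ⟨i, Nat.lt_succ_self i, rfl⟩)

theorem SOTRelCompact.tendsto_iSup_tsum {B₀ : Set (H →L[ℂ] K)} (h : SOTRelCompact B₀)
    {C : ℝ} (hC : ∀ A ∈ B₀, ‖A‖ ≤ C) {φ : ℕ → H} (hφ : ∀ i, ‖φ i‖ = 1)
    {p : ℕ → ℝ} (hp : ∀ i, 0 ≤ p i) (hps : Summable p)
    {P : ℕ → K →L[ℂ] K} (hP : ∀ m, IsFinRankProj (P m))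
    (hPx : ∀ x : K, Tendsto (fun m => P m x) atTop (𝓝 x)) :
    Tendsto (fun m => ⨆ A : B₀, ∑' i, p i * ‖((1 : K →L[ℂ] K) - P m) (A.1 (φ i))‖ ^ 2)
      atTop (𝓝 0) := by
  have hnorm : ∀ m i, ∀ A : B₀, ‖((1 : K →L[ℂ] K) - P m) (A.1 (φ i))‖ ^ 2 ≤ C ^ 2 := by
    intro m i A
    gcongr
    refine ((1 - P m).le_of_opNorm_le (hP m).norm_one_sub_le _).trans ?_
    have := A.1.le_of_opNorm_le (hC A.1 A.2) (φ i)
    rwa [hφ, mul_one, ← one_mul ‖A.1 (φ i)‖] at this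
  have hbdd : ∀ m i, BddAbove (Set.range fun A : B₀ =>
      ‖((1 : K →L[ℂ] K) - P m) (A.1 (φ i))‖ ^ 2) := by
    intro m i
    refine ⟨C ^ 2, ?_⟩
    rintro _ ⟨A, rfl⟩
    exact hnorm m i A
  set s : ℕ → ℕ → ℝ := fun m i => ⨆ A : B₀, ‖((1 : K →L[ℂ] K) - P m) (A.1 (φ i))‖ ^ 2 with hs
  have hs0 : ∀ m i, 0 ≤ s m i := fun m i => Real.iSup_nonneg fun A => by positivity
  have hsC : ∀ m i, s m i ≤ C ^ 2 := fun m i => Real.iSup_le (hnorm m i) (sq_nonneg C)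
  have hlim : ∀ i, Tendsto (fun m => s m i) atTop (𝓝 0) := by
    intro i
    rw [Metric.tendsto_atTop']
    intro ε hε
    have := (h.totallyBounded (φ i)).eventually_norm_le
      (T := fun m x => ((1 : K →L[ℂ] K) - P m) x)
      (fun m x y => by
        rw [← map_sub]
        simpa using (1 - P m).le_of_opNorm_le (hP m).norm_one_sub_le (x - y))
      (fun x _ => by simpa using (hPx x).const_sub x)
      (ε := Real.sqrt (ε / 2)) (by positivity)
    obtain ⟨N, hN⟩ := eventually_atTop.1 this
    refine ⟨N, fun m hm => ?_⟩
    rw [Real.dist_0_eq_abs, abs_of_nonneg (hs0 m i)]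
    refine lt_of_le_of_lt (Real.iSup_le (fun A => ?_) (by positivity)) (half_lt_self hε)
    rw [← Real.le_sqrt (norm_nonneg _) (by positivity)]
    exact hN m hm.le _ ⟨A.1, A.2, rfl⟩
  have hsum : ∀ m, Summable fun i => p i * s m i := fun m =>
    (hps.mul_right (C ^ 2)).of_nonneg_of_le (fun i => mul_nonneg (hp i) (hs0 m i))
      fun i => mul_le_mul_of_nonneg_left (hsC m i) (hp i)
  have hlim2 : Tendsto (fun m => ∑' i, p i * s m i) atTop (𝓝 0) := by
    have := tendsto_tsum_of_dominated_convergence (𝓕 := atTop)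
      (f := fun m i => p i * s m i) (g := fun _ => (0 : ℝ)) (hps.mul_right (C ^ 2))
      (fun i => by simpa using (hlim i).const_mul (p i))
      (Eventually.of_forall fun m i => by
        rw [Real.norm_of_nonneg (mul_nonneg (hp i) (hs0 m i))]
        exact mul_le_mul_of_nonneg_left (hsC m i) (hp i))
    simpa using this
  refine squeeze_zero (fun m => Real.iSup_nonneg fun A => tsum_nonneg fun i =>
    mul_nonneg (hp i) (by positivity)) (fun m => ?_) hlim2
  refine Real.iSup_le (fun A => ?_) (tsum_nonneg fun i => mul_nonneg (hp i) (hs0 m i))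
  have hle : ∀ i, p i * ‖((1 : K →L[ℂ] K) - P m) (A.1 (φ i))‖ ^ 2 ≤ p i * s m i := fun i =>
    mul_le_mul_of_nonneg_left (le_ciSup (hbdd m i) A) (hp i)
  exact ((hsum m).of_nonneg_of_le (fun i => mul_nonneg (hp i) (by positivity)) hle).tsum_le_tsum
    hle (hsum m)

variable [CompleteSpace H]

theorem sotRelCompact_of_forall_totallyBounded {B₀ : Set (H →L[ℂ] K)} (d : ℕ → H)
    (hd : Dense (Submodule.span ℂ (Set.range d) : Set H)) {C : ℝ} (hC : ∀ A ∈ B₀, ‖A‖ ≤ C)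
    (h : ∀ i, TotallyBounded ((fun A : H →L[ℂ] K => A (d i)) '' B₀)) : SOTRelCompact B₀ := by
  intro a ha
  have hcomp := isCompact_univ_pi fun i => (h i).closure.isCompact_of_isClosed isClosed_closure
  obtain ⟨z, -, k, hk, hz⟩ := hcomp.isSeqCompact (x := fun n i => a n (d i))
    fun n i _ => subset_closure ⟨a n, ha n, rfl⟩
  rw [tendsto_pi_nhds] at hz
  have hspan : ∀ y ∈ Submodule.span ℂ (Set.range d),
      ∃ w, Tendsto (fun n => a (k n) y) atTop (𝓝 w) := by
    intro y hy
    induction hy using Submodule.span_induction with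
    | mem x hx =>
      obtain ⟨i, rfl⟩ := hx
      exact ⟨_, hz i⟩
    | zero => exact ⟨0, by simp⟩
    | add x y _ _ hx hy =>
      obtain ⟨u, hu⟩ := hx
      obtain ⟨v, hv⟩ := hy
      exact ⟨u + v, by simpa using hu.add hv⟩
    | smul c x _ hx =>
      obtain ⟨u, hu⟩ := hx
      exact ⟨c • u, by simpa using hu.const_smul c⟩
  have hall : ∀ x, ∃ w, Tendsto (fun n => a (k n) x) atTop (𝓝 w) := by
    intro x
    refine cauchySeq_tendsto_of_complete (Metric.cauchySeq_iff'.2 fun ε hε => ?_)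
    have hC1 : 0 < |C| + 1 := by positivity
    obtain ⟨y, hy, hxy⟩ := hd.exists_dist_lt x (show 0 < ε / (3 * (|C| + 1)) by positivity)
    obtain ⟨w, hw⟩ := hspan y hy
    obtain ⟨N, hN⟩ := Metric.cauchySeq_iff'.1 hw.cauchySeq (ε / 3) (by positivity)
    have key : ∀ n, dist (a (k n) x) (a (k n) y) < ε / 3 := by
      intro n
      rw [dist_eq_norm, ← map_sub]
      calc ‖a (k n) (x - y)‖ ≤ ‖a (k n)‖ * ‖x - y‖ := (a (k n)).le_opNorm _
        _ ≤ (|C| + 1) * ‖x - y‖ := by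
            gcongr
            linarith [hC _ (ha (k n)), le_abs_self C]
        _ < (|C| + 1) * (ε / (3 * (|C| + 1))) := by
            rw [← dist_eq_norm]
            gcongr
        _ = ε / 3 := by field_simp
    refine ⟨N, fun n hn => ?_⟩
    have h1 := key n
    have h2 := key N
    have h3 := hN n hn
    rw [dist_comm] at h2
    linarith [dist_triangle4 (a (k n) x) (a (k n) y) (a (k N) y) (a (k N) x)]
  choose f hf using hall
  exact ⟨k, continuousLinearMapOfTendsto (fun n => a (k n)) (tendsto_pi_nhds.2 hf), hk, hf⟩

theorem sotRelCompact_of_tendsto_iSup_tsum {B₀ : Set (H →L[ℂ] K)}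
    {C : ℝ} (hC : ∀ A ∈ B₀, ‖A‖ ≤ C) (φ : HilbertBasis ℕ ℂ H)
    {p : ℕ → ℝ} (hp : ∀ i, 0 < p i) (hps : Summable p)
    {P : ℕ → K →L[ℂ] K} (hP : ∀ m, IsFinRankProj (P m))
    (h : Tendsto (fun m => ⨆ A : B₀, ∑' i, p i * ‖((1 : K →L[ℂ] K) - P m) (A.1 (φ i))‖ ^ 2)
      atTop (𝓝 0)) : SOTRelCompact B₀ := by
  have hφ : ∀ i, ‖φ i‖ = 1 := fun i => φ.orthonormal.1 i
  refine sotRelCompact_of_forall_totallyBounded φ φ.dense_span_range hC fun i => ?_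
  refine totallyBounded_of_finiteRank_approx ?_ fun ε hε => ?_
  · rw [isBounded_iff_forall_norm_le]
    refine ⟨C, ?_⟩
    rintro _ ⟨A, hA, rfl⟩
    simpa [hφ] using A.le_of_opNorm_le (hC A hA) (φ i)
  obtain ⟨m, hm⟩ := (h.eventually_le_const (mul_pos (hp i) (pow_pos hε 2))).exists
  refine ⟨P m, (hP m).2.2, ?_⟩
  rintro _ ⟨A, hA, rfl⟩
  have hterm : ∀ (A : B₀) (j : ℕ),
      p j * ‖((1 : K →L[ℂ] K) - P m) (A.1 (φ j))‖ ^ 2 ≤ p j * C ^ 2 := by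
    intro A j
    refine mul_le_mul_of_nonneg_left ?_ (hp j).le
    gcongr
    refine ((1 - P m).le_of_opNorm_le (hP m).norm_one_sub_le _).trans ?_
    have := A.1.le_of_opNorm_le (hC A.1 A.2) (φ j)
    rwa [hφ, mul_one, ← one_mul ‖A.1 (φ j)‖] at this
  have hnn : ∀ (A : B₀) (j : ℕ), 0 ≤ p j * ‖((1 : K →L[ℂ] K) - P m) (A.1 (φ j))‖ ^ 2 :=
    fun A j => mul_nonneg (hp j).le (by positivity)
  have hsum : ∀ A : B₀, Summable fun j => p j * ‖((1 : K →L[ℂ] K) - P m) (A.1 (φ j))‖ ^ 2 :=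
    fun A => (hps.mul_right (C ^ 2)).of_nonneg_of_le (hnn A) (hterm A)
  have hbdd : BddAbove (Set.range fun A : B₀ =>
      ∑' j, p j * ‖((1 : K →L[ℂ] K) - P m) (A.1 (φ j))‖ ^ 2) := by
    refine ⟨∑' j, p j * C ^ 2, ?_⟩
    rintro _ ⟨A, rfl⟩
    exact (hsum A).tsum_le_tsum (hterm A) (hps.mul_right (C ^ 2))
  have h1 : p i * ‖((1 : K →L[ℂ] K) - P m) (A (φ i))‖ ^ 2 ≤ p i * ε ^ 2 :=
    (((hsum ⟨A, hA⟩).le_tsum i fun j _ => hnn ⟨A, hA⟩ j).trans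
      (le_ciSup hbdd ⟨A, hA⟩)).trans hm
  have h2 := le_of_mul_le_mul_left h1 (hp i)
  simpa using (pow_le_pow_iff_left₀ (norm_nonneg _) hε.le two_ne_zero).1 h2

theorem SOTConv.tnConv_conj {ι : Type*} (e : HilbertBasis ι ℂ K) {a : ℕ → H →L[ℂ] K}
    {A : H →L[ℂ] K} (h : SOTConv a A) {C : ℝ} (hC : ∀ n, ‖a n‖ ≤ C) {σ : H →L[ℂ] H}
    (hσ : IsTC σ) :
    TNConv e (fun n => a n ∘L σ ∘L adjoint (a n)) (A ∘L σ ∘L adjoint A) := by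
  obtain ⟨f, g, hσ⟩ : ∃ f g : ℕ → H, IsNuclearRep σ f g := hσ
  have hC0 : 0 ≤ C := (norm_nonneg _).trans (hC 0)
  have hsub : ∀ n, ‖a n - A‖ ≤ C + ‖A‖ := fun n =>
    (norm_sub_le _ _).trans (by gcongr; exact hC n)
  have hrep : ∀ n, IsNuclearRep
      (a n ∘L σ ∘L adjoint (a n) - A ∘L σ ∘L adjoint A)
      (Sum.elim (fun k => (a n - A) (f k)) fun k => -(A (f k)))
      (Sum.elim (fun k => a n (g k)) fun k => (A - a n) (g k)) := by
    intro n
    have h1 := ((hσ.comp_left (a n - A)).comp_adjoint (a n)).sub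
      ((hσ.comp_left A).comp_adjoint (A - a n))
    have h2 : ((a n - A) ∘L σ) ∘L adjoint (a n) - (A ∘L σ) ∘L adjoint (A - a n) =
        a n ∘L σ ∘L adjoint (a n) - A ∘L σ ∘L adjoint A := by
      ext x
      simp
    rwa [h2] at h1
  have h1 : ∀ k, Tendsto (fun n => ‖(a n - A) (f k)‖) atTop (𝓝 0) := fun k => by
    simpa using ((h (f k)).sub_const (A (f k))).norm
  have h2 : ∀ k, Tendsto (fun n => ‖(A - a n) (g k)‖) atTop (𝓝 0) := fun k => by
    simpa using ((h (g k)).const_sub (A (g k))).norm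
  have hbound : Summable fun k => (C + ‖A‖) * C * (‖f k‖ * ‖g k‖) := hσ.1.mul_left _
  have hbound' : Summable fun k => (C + ‖A‖) * ‖A‖ * (‖f k‖ * ‖g k‖) := hσ.1.mul_left _
  have hle : ∀ n k, ‖(a n - A) (f k)‖ * ‖a n (g k)‖ ≤ (C + ‖A‖) * C * (‖f k‖ * ‖g k‖) := by
    intro n k
    calc ‖(a n - A) (f k)‖ * ‖a n (g k)‖ ≤ ((C + ‖A‖) * ‖f k‖) * (C * ‖g k‖) := by
          gcongr
          · exact le_of_opNorm_le _ (hsub n) _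
          · exact le_of_opNorm_le _ (hC n) _
      _ = _ := by ring
  have hle' : ∀ n k, ‖A (f k)‖ * ‖(A - a n) (g k)‖ ≤
      (C + ‖A‖) * ‖A‖ * (‖f k‖ * ‖g k‖) := by
    intro n k
    calc ‖A (f k)‖ * ‖(A - a n) (g k)‖ ≤ (‖A‖ * ‖f k‖) * ((C + ‖A‖) * ‖g k‖) := by
          gcongr
          · exact le_opNorm _ _
          · exact le_of_opNorm_le _ (by rw [norm_sub_rev]; exact hsub n) _
      _ = _ := by ring
  have hlim1 : Tendsto (fun n => ∑' k, ‖(a n - A) (f k)‖ * ‖a n (g k)‖) atTop (𝓝 0) := by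
    have := tendsto_tsum_of_dominated_convergence (𝓕 := atTop)
      (f := fun n k => ‖(a n - A) (f k)‖ * ‖a n (g k)‖) (g := fun _ => (0 : ℝ)) hbound
      (fun k => by simpa using (h1 k).mul (h (g k)).norm)
      (Eventually.of_forall fun n k => by simpa using hle n k)
    simpa using this
  have hlim2 : Tendsto (fun n => ∑' k, ‖A (f k)‖ * ‖(A - a n) (g k)‖) atTop (𝓝 0) := by
    have := tendsto_tsum_of_dominated_convergence (𝓕 := atTop)
      (f := fun n k => ‖A (f k)‖ * ‖(A - a n) (g k)‖) (g := fun _ => (0 : ℝ)) hbound'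
      (fun k => by simpa using (h2 k).const_mul _)
      (Eventually.of_forall fun n k => by simpa using hle' n k)
    simpa using this
  refine squeeze_zero (fun n => tnorm_nonneg e _) (fun n => ?_) (by simpa using hlim1.add hlim2)
  refine ((hrep n).tnorm_le e).trans (le_of_eq ?_)
  have hs := (hrep n).1
  rw [Summable.tsum_sum (hs.comp_injective Sum.inl_injective)
    (hs.comp_injective Sum.inr_injective)]
  simp

theorem IsPTC.conj_adjoint {σ : H →L[ℂ] H} (hσ : IsPTC σ) (A : H →L[ℂ] K) :
    IsPTC (A ∘L σ ∘L adjoint A) := by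
  obtain ⟨f, g, h⟩ : ∃ f g : ℕ → H, IsNuclearRep σ f g := hσ.2
  exact ⟨hσ.1.conj_adjoint A, _, _, (h.comp_left A).comp_adjoint A⟩

theorem SOTRelCompact.tnRelCompactIn {ι : Type*} (e : HilbertBasis ι ℂ K)
    {B₀ : Set (H →L[ℂ] K)} (h : SOTRelCompact B₀) {C : ℝ} (hC : ∀ A ∈ B₀, ‖A‖ ≤ C)
    {σ : H →L[ℂ] H} (hσ : IsPTC σ) :
    TNRelCompactIn e {ρ | IsPTC ρ} {x | ∃ A ∈ B₀, x = A ∘L σ ∘L adjoint A} := by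
  intro x hx
  choose a ha hax using hx
  obtain ⟨k, A, hk, hA⟩ := h a ha
  refine ⟨k, _, hk, hσ.conj_adjoint A, ?_⟩
  simpa only [hax] using hA.tnConv_conj e (fun n => hC _ (ha (k n))) hσ.2

theorem sotRelCompact_of_tnRelCompactIn (eH : HilbertBasis ℕ ℂ H) (eK : HilbertBasis ℕ ℂ K)
    {B₀ : Set (H →L[ℂ] K)} {C : ℝ} (hC : ∀ A ∈ B₀, ‖A‖ ≤ C) {σ : H →L[ℂ] H} (hσ : IsPTC σ)
    (hker : ∀ x, σ x = 0 → x = 0)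
    (h : TNRelCompactIn eK {ρ | IsPTC ρ} {x | ∃ A ∈ B₀, x = A ∘L σ ∘L adjoint A}) :
    SOTRelCompact B₀ := by
  set F : Set (K →L[ℂ] K) := {x | ∃ A ∈ B₀, x = A ∘L σ ∘L adjoint A} with hF
  have hFP : ∀ x ∈ F, IsPTC x := by
    rintro _ ⟨A, -, rfl⟩
    exact hσ.conj_adjoint A
  have hFtb : TotallyBounded F := by
    refine totallyBounded_of_forall_seq fun u hu => ?_
    obtain ⟨k, L, hk, hL, hlim⟩ := h u hu
    refine ⟨k, L, hk, ?_⟩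
    rw [tendsto_iff_norm_sub_tendsto_zero]
    refine squeeze_zero (fun n => norm_nonneg _) (fun n => ?_) hlim
    obtain ⟨f, g, h1⟩ : ∃ f g : ℕ → K, IsNuclearRep (u (k n)) f g := (hFP _ (hu (k n))).2
    obtain ⟨f', g', h2⟩ : ∃ f g : ℕ → K, IsNuclearRep L f g := hL.2
    exact (h1.sub h2).norm_le_tnorm eK
  obtain ⟨P, hP, -, hPx⟩ := eK.exists_isFinRankProj_tendsto
  have hQ0 : ∀ x, Tendsto (fun m => ((1 : K →L[ℂ] K) - P m) x) atTop (𝓝 0) := fun x => by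
    simpa using (hPx x).const_sub x
  obtain ⟨b, hb⟩ := CStarAlgebra.nonneg_iff_eq_star_mul_self.1
    ((nonneg_iff_isPositive σ).2 hσ.1)
  have hbσ : σ = adjoint b ∘L b := hb
  have hdense : DenseRange (adjoint b) := by
    have h1 : (LinearMap.range (adjoint b : H →ₗ[ℂ] H))ᗮ = ⊥ := by
      rw [ContinuousLinearMap.orthogonal_range, adjoint_adjoint, LinearMap.ker_eq_bot']
      intro x hx
      refine hker x ?_
      have : b x = 0 := hx
      simp [hbσ, this]
    exact (Submodule.dense_iff_topologicalClosure_eq_top).2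
      ((Submodule.topologicalClosure_eq_top_iff).2 h1)
  refine sotRelCompact_of_forall_totallyBounded (fun i => adjoint b (eH i)) ?_ hC fun i => ?_
  · have h1 := hdense.dense_image (adjoint b).continuous eH.dense_span_range
    refine h1.mono ?_
    rintro _ ⟨x, hx, rfl⟩
    have := Submodule.mem_map_of_mem (f := (adjoint b : H →ₗ[ℂ] H)) hx
    rw [Submodule.map_span, ← Set.range_comp] at this
    exact this
  · refine totallyBounded_of_finiteRank_approx ?_ fun ε hε => ?_
    · rw [isBounded_iff_forall_norm_le]
      refine ⟨C * ‖adjoint b (eH i)‖, ?_⟩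
      rintro _ ⟨A, hA, rfl⟩
      exact A.le_of_opNorm_le (hC A hA) _
    · obtain ⟨m, hm⟩ := (hFtb.eventually_norm_le
        (T := fun m (a : K →L[ℂ] K) => ((1 : K →L[ℂ] K) - P m) ∘L a)
        (fun m x y => by
          rw [← comp_sub]
          exact (opNorm_comp_le _ _).trans
            (mul_le_of_le_one_left (norm_nonneg _) (hP m).norm_one_sub_le))
        (fun x hx => (hFP x hx).2.tendsto_norm_comp (fun m => (hP m).norm_one_sub_le) hQ0)
        (pow_pos hε 2)).exists
      refine ⟨P m, (hP m).2.2, ?_⟩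
      rintro _ ⟨A, hA, rfl⟩
      set Q : K →L[ℂ] K := 1 - P m with hQ
      have hQn : ‖Q‖ ≤ 1 := (hP m).norm_one_sub_le
      set S : K →L[ℂ] H := b ∘L adjoint A ∘L adjoint Q with hS
      have h1 : adjoint S ∘L S = (Q ∘L (A ∘L σ ∘L adjoint A)) ∘L adjoint Q := by
        rw [hS, hbσ]
        simp only [adjoint_comp, adjoint_adjoint, comp_assoc]
      have h2 : ‖S‖ ^ 2 ≤ ε ^ 2 := by
        rw [sq, ← norm_adjoint_comp_self, h1]
        refine (opNorm_comp_le _ _).trans ?_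
        rw [LinearIsometryEquiv.norm_map]
        exact (mul_le_of_le_one_right (norm_nonneg _) hQn).trans (hm _ ⟨A, hA, rfl⟩)
      have h3 : ‖adjoint S‖ ≤ ε := by
        rw [LinearIsometryEquiv.norm_map]
        exact (pow_le_pow_iff_left₀ (norm_nonneg _) hε.le two_ne_zero).1 h2
      have h4 : A (adjoint b (eH i)) - P m (A (adjoint b (eH i))) = adjoint S (eH i) := by
        rw [hS, hQ]
        simp [adjoint_comp]
      rw [h4]
      simpa [eH.orthonormal.1 i] using (adjoint S).le_of_opNorm_le h3 (eH i)

theorem exists_isFaithfulState (e : HilbertBasis ℕ ℂ H) : ∃ σ : H →L[ℂ] H, IsFaithfulState e σ := by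
  let p : ℕ → ℝ := fun i => 1 / 2 / 2 ^ i
  have hp : ∀ i, 0 < p i := fun i => by positivity
  have hps : HasSum p 1 := hasSum_geometric_two' 1
  have he : ∀ i, ‖e i‖ = 1 := fun i => e.orthonormal.1 i
  let t : ℕ → H →L[ℂ] H := fun i => (p i : ℂ) • rankOne (e i) (e i)
  have hR : ∀ i, ‖rankOne (e i) (e i)‖ ≤ 1 := fun i => by
    refine opNorm_le_bound _ zero_le_one fun x => ?_
    simpa [rankOne, norm_smul, he] using norm_inner_le_norm (𝕜 := ℂ) (e i) x
  have ht : Summable t := by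
    refine Summable.of_norm_bounded hps.summable fun i => ?_
    rw [norm_smul, Complex.norm_real, Real.norm_of_nonneg (hp i).le]
    exact mul_le_of_le_one_right (hp i).le (hR i)
  have htpos : ∀ i, (t i).IsPositive := fun i => by
    have h1 : rankOne (e i) (e i) =
        toSpanSingleton ℂ (e i) ∘L adjoint (toSpanSingleton ℂ (e i)) := by
      rw [adjoint_toSpanSingleton]
      rfl
    refine IsPositive.smul_of_nonneg ?_ (by exact_mod_cast (hp i).le)
    rw [h1]
    simpa using isPositive_id.conj_adjoint (toSpanSingleton ℂ (e i))
  obtain ⟨σ, hσ⟩ := ht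
  have hx : ∀ x, HasSum (fun i => ⟪e i, x⟫ • ((p i : ℂ) • e i)) (σ x) := fun x => by
    refine (hσ.mapL (ContinuousLinearMap.apply ℂ H x)).congr_fun ?_
    intro i
    exact smul_comm _ _ _
  have hinner : ∀ j x, ⟪e j, σ x⟫ = p j * ⟪e j, x⟫ := fun j x => by
    refine ((hx x).mapL (innerSL ℂ (e j))).unique ?_
    have h1 : ∀ i, i ≠ j → innerSL ℂ (e j) (⟪e i, x⟫ • ((p i : ℂ) • e i)) = 0 := fun i hij => by
      have : ⟪e j, e i⟫ = (0 : ℂ) := e.orthonormal.2 hij.symm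
      simp only [innerSL_apply_apply, inner_smul_right, this, mul_zero]
    have h2 := hasSum_single j h1
    have h3 : innerSL ℂ (e j) (⟪e j, x⟫ • ((p j : ℂ) • e j)) = p j * ⟪e j, x⟫ := by
      simp only [innerSL_apply_apply, inner_smul_right, inner_self_eq_norm_sq_to_K, he]
      simp [mul_comm]
    rwa [h3] at h2
  refine ⟨σ, ⟨?_, ?_, ?_⟩, fun x hx0 => ?_⟩
  · rw [← nonneg_iff_isPositive]
    exact hσ.nonneg fun i => (nonneg_iff_isPositive _).2 (htpos i)
  · refine ⟨_, _, ?_, hx⟩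
    simpa [norm_smul, he, abs_of_pos (hp _)] using hps.summable
  · have h1 : ∀ i, ⟪e i, σ (e i)⟫ = (p i : ℂ) := fun i => by
      rw [hinner, inner_self_eq_norm_sq_to_K, he]
      simp
    simp only [trC, h1]
    exact_mod_cast hps.tsum_eq
  · refine (LinearIsometryEquiv.map_eq_zero_iff e.repr).1 (lp.ext (funext fun i => ?_))
    have h1 := hinner i x
    rw [hx0, inner_zero_right, eq_comm, mul_eq_zero] at h1
    rw [e.repr_apply_apply]
    exact h1.resolve_left (by exact_mod_cast (hp i).ne')

end Auxiliary

section Statement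

variable {H K : Type*} [NormedAddCommGroup H] [InnerProductSpace ℂ H] [CompleteSpace H]
  [NormedAddCommGroup K] [InnerProductSpace ℂ K] [CompleteSpace K]

/-- Criterion of relative compactness of bounded subsets of `B(H,K)` in the strong operator
topology: conditions (i) (SOT relative compactness), (ii) (relative trace-norm compactness of
`{AσA* : A ∈ B₀}` for some faithful state `σ`) and (iii) (a uniform tail condition w.r.t. an
orthonormal basis and a nondegenerate probability distribution) are equivalent; moreover, if
they hold then `{AσA*}` is relatively compact for every state `σ`, and the tail condition holds
for arbitrary families of unit vectors, probability distributions, and increasing sequences of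
finite-rank projections tending strongly to the identity. -/
theorem SOT_relative_compactness_criterion
    (eH : HilbertBasis ℕ ℂ H) (eK : HilbertBasis ℕ ℂ K)
    (B₀ : Set (H →L[ℂ] K)) (hbdd : ∃ C, ∀ A ∈ B₀, ‖A‖ ≤ C) :
    (SOTRelCompact B₀ ↔
      ∃ σ : H →L[ℂ] H, IsFaithfulState eH σ ∧
        TNRelCompactIn eK {ρ | IsPTC ρ}
          {x | ∃ A ∈ B₀, x = A ∘L σ ∘L ContinuousLinearMap.adjoint A}) ∧
    (SOTRelCompact B₀ ↔
      ∃ (φ : HilbertBasis ℕ ℂ H) (p : ℕ → ℝ), (∀ i, 0 < p i) ∧ HasSum p 1 ∧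
        ∃ P : ℕ → K →L[ℂ] K, (∀ m, IsFinRankProj (P m)) ∧
          Tendsto
            (fun m => ⨆ A : B₀, ∑' i, p i * ‖((1 : K →L[ℂ] K) - P m) (A.1 (φ i))‖ ^ 2)
            atTop (nhds 0)) ∧
    (SOTRelCompact B₀ → ∀ σ : H →L[ℂ] H, IsState eH σ →
      TNRelCompactIn eK {ρ | IsPTC ρ}
        {x | ∃ A ∈ B₀, x = A ∘L σ ∘L ContinuousLinearMap.adjoint A}) ∧
    (SOTRelCompact B₀ → ∀ φ : ℕ → H, (∀ i, ‖φ i‖ = 1) →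
      ∀ p : ℕ → ℝ, (∀ i, 0 ≤ p i) → HasSum p 1 →
      ∀ P : ℕ → K →L[ℂ] K, (∀ m, IsFinRankProj (P m)) →
        (∀ m, P (m + 1) ∘L P m = P m) →
        (∀ x : K, Tendsto (fun m => P m x) atTop (nhds x)) →
        Tendsto
          (fun m => ⨆ A : B₀, ∑' i, p i * ‖((1 : K →L[ℂ] K) - P m) (A.1 (φ i))‖ ^ 2)
          atTop (nhds 0)) := by
  obtain ⟨C, hC⟩ := hbdd
  refine ⟨⟨fun h => ?_, ?_⟩, ⟨fun h => ?_, ?_⟩, ?_, ?_⟩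
  · obtain ⟨σ, hσ⟩ := exists_isFaithfulState eH
    exact ⟨σ, hσ, h.tnRelCompactIn eK hC ⟨hσ.1.1, hσ.1.2.1⟩⟩
  · rintro ⟨σ, hσ, h⟩
    exact sotRelCompact_of_tnRelCompactIn eH eK hC ⟨hσ.1.1, hσ.1.2.1⟩ hσ.2 h
  · obtain ⟨P, hP, -, hPx⟩ := eK.exists_isFinRankProj_tendsto
    have hps : HasSum (fun i : ℕ => (1 : ℝ) / 2 / 2 ^ i) 1 := hasSum_geometric_two' 1
    exact ⟨eH, _, fun i => by positivity, hps, P, hP,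
      h.tendsto_iSup_tsum hC eH.orthonormal.1 (fun i => by positivity) hps.summable hP hPx⟩
  · rintro ⟨φ, p, hp, hps, P, hP, h⟩
    exact sotRelCompact_of_tendsto_iSup_tsum hC φ hp hps.summable hP h
  · exact fun h σ hσ => h.tnRelCompactIn eK hC ⟨hσ.1, hσ.2.1⟩
  · exact fun h φ hφ p hp hps P hP _ hPx => h.tendsto_iSup_tsum hC hφ hp hps.summable hP hPx

end Statement
end
end

section
/- Let {V_n} be a sequence of contractions from H_A to H_B such that the sequence of quantum operations Φ_n(ρ) = V_n ρ V_n* converges strongly to a quantum operation Φ₀. Then there exist a subsequence {V_{n_k}} and a contraction V₀: H_A → H_B such that V_{n_k} → V₀ in the strong operator topology and Φ₀(ρ) = V₀ ρ V₀* for all ρ ∈ T(H_A). -/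
open Filter Topology ContinuousLinearMap
open scoped ComplexOrder

noncomputable section

section RankOneKraus

variable {H K : Type*} [NormedAddCommGroup H] [InnerProductSpace ℂ H]
  [NormedAddCommGroup K] [InnerProductSpace ℂ K]

theorem rankOne_apply (y : K) (z x : H) : rankOne y z x = ⟪z, x⟫ • y := by
  simp [rankOne]

theorem norm_rankOne (y : K) (z : H) : ‖rankOne y z‖ = ‖y‖ * ‖z‖ := by
  have : rankOne y z = (innerSL ℂ z).smulRight y := by
    ext x
    simp [rankOne_apply]
  rw [this, ContinuousLinearMap.norm_smulRight_apply, innerSL_apply_norm, mul_comm]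

theorem comp_rankOne_comp_adjoint [CompleteSpace H] [CompleteSpace K] (V : H →L[ℂ] K) (x y : H) :
    V ∘L rankOne x y ∘L adjoint V = rankOne (V x) (V y) := by
  ext w
  simp [rankOne_apply, adjoint_inner_right]

/-- A nuclear representation `A = ∑ |f n⟩⟨g n|` with square-summable vectors. -/
def IsSqRep (A : H →L[ℂ] K) (f : ℕ → K) (g : ℕ → H) : Prop :=
  Summable (fun n => ‖f n‖ ^ 2) ∧ Summable (fun n => ‖g n‖ ^ 2) ∧
    ∀ x : H, HasSum (fun n => ⟪g n, x⟫ • f n) (A x)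

theorem IsTC.exists_isSqRep {A : H →L[ℂ] K} (hA : IsTC A) : ∃ f g, IsSqRep A f g := by
  obtain ⟨f, g, hs, h⟩ := hA
  refine ⟨fun n => ((√(‖g n‖ / ‖f n‖) : ℝ) : ℂ) • f n,
    fun n => ((√(‖f n‖ / ‖g n‖) : ℝ) : ℂ) • g n, ?_, ?_, fun x => ?_⟩
  · refine hs.congr fun n => ?_
    rw [norm_smul, mul_pow, Complex.norm_real, Real.norm_eq_abs, sq_abs,
      Real.sq_sqrt (by positivity)]
    by_cases hf : ‖f n‖ = 0
    · simp [hf]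
    · field_simp
  · refine hs.congr fun n => ?_
    rw [norm_smul, mul_pow, Complex.norm_real, Real.norm_eq_abs, sq_abs,
      Real.sq_sqrt (by positivity)]
    by_cases hg : ‖g n‖ = 0
    · simp [hg]
    · field_simp
  · convert! h x using 2 with n
    rw [inner_smul_left, Complex.conj_ofReal, smul_smul]
    by_cases hf : f n = 0
    · simp [hf]
    by_cases hg : g n = 0
    · simp [hg]
    have h1 : √(‖f n‖ / ‖g n‖) * √(‖g n‖ / ‖f n‖) = 1 := by
      rw [← Real.sqrt_mul (by positivity), div_mul_div_comm, mul_comm ‖g n‖, div_self, Real.sqrt_one]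
      exact mul_ne_zero (norm_ne_zero_iff.2 hf) (norm_ne_zero_iff.2 hg)
    have h2 : ((√(‖f n‖ / ‖g n‖) : ℝ) : ℂ) * ((√(‖g n‖ / ‖f n‖) : ℝ) : ℂ) = 1 := by
      exact_mod_cast h1
    congr 1
    linear_combination ⟪g n, x⟫ * h2

theorem IsSqRep.summable_mul {A : H →L[ℂ] K} {f : ℕ → K} {g : ℕ → H} (h : IsSqRep A f g) :
    Summable (fun n => ‖f n‖ * ‖g n‖) := by
  refine Summable.of_nonneg_of_le (fun n => by positivity) (fun n => ?_)
    ((h.1.add h.2.1).div_const 2)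
  nlinarith [sq_nonneg (‖f n‖ - ‖g n‖)]

theorem IsSqRep.isTC {A : H →L[ℂ] K} {f : ℕ → K} {g : ℕ → H} (h : IsSqRep A f g) : IsTC A :=
  ⟨f, g, h.summable_mul, h.2.2⟩

theorem IsSqRep.comp {L : Type*} [NormedAddCommGroup L] [InnerProductSpace ℂ L]
    {A : H →L[ℂ] K} {f : ℕ → K} {g : ℕ → H} (h : IsSqRep A f g) (B : K →L[ℂ] L) :
    IsSqRep (B ∘L A) (fun n => B (f n)) g := by
  refine ⟨?_, h.2.1, fun x => ?_⟩
  · refine Summable.of_nonneg_of_le (fun n => by positivity) (fun n => ?_)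
      (h.1.mul_left (‖B‖ ^ 2))
    rw [← mul_pow]
    gcongr
    exact B.le_opNorm _
  · simpa using (h.2.2 x).mapL B

theorem IsTC.comp_left {L : Type*} [NormedAddCommGroup L] [InnerProductSpace ℂ L]
    {A : H →L[ℂ] K} (hA : IsTC A) (B : K →L[ℂ] L) : IsTC (B ∘L A) := by
  obtain ⟨f, g, h⟩ := hA.exists_isSqRep
  exact (h.comp B).isTC

theorem IsTC.comp_adjoint {L : Type*} [NormedAddCommGroup L] [InnerProductSpace ℂ L]
    [CompleteSpace H] [CompleteSpace L] {A : H →L[ℂ] K} (hA : IsTC A) (B : H →L[ℂ] L) : IsTC (A ∘L adjoint B) := by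
  obtain ⟨f, g, hs, h⟩ := hA
  refine ⟨f, fun n => B (g n), ?_, fun x => ?_⟩
  · refine Summable.of_nonneg_of_le (fun n => by positivity) (fun n => ?_) (hs.mul_left ‖B‖)
    rw [mul_left_comm]
    gcongr
    exact B.le_opNorm _
  · simpa [adjoint_inner_right] using h (adjoint B x)

theorem IsTC.smul {A : H →L[ℂ] K} (hA : IsTC A) (c : ℂ) : IsTC (c • A) := by
  simpa using hA.comp_left (c • ContinuousLinearMap.id ℂ K)

theorem IsTC.add {A B : H →L[ℂ] K} (hA : IsTC A) (hB : IsTC B) : IsTC (A + B) := by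
  obtain ⟨f, g, hs, h⟩ := hA
  obtain ⟨f', g', hs', h'⟩ := hB
  let φ : ℕ ≃ ℕ ⊕ ℕ := Equiv.natSumNatEquivNat.symm
  refine ⟨fun n => Sum.elim f f' (φ n), fun n => Sum.elim g g' (φ n), ?_, fun x => ?_⟩
  · exact (φ.summable_iff (f := fun s => ‖Sum.elim f f' s‖ * ‖Sum.elim g g' s‖)).2
      (HasSum.sum (f := fun s => ‖Sum.elim f f' s‖ * ‖Sum.elim g g' s‖)
        hs.hasSum hs'.hasSum).summable
  · exact (φ.hasSum_iff (f := fun s => ⟪Sum.elim g g' s, x⟫ • Sum.elim f f' s)).2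
      (HasSum.sum (f := fun s => ⟪Sum.elim g g' s, x⟫ • Sum.elim f f' s) (h x) (h' x))

theorem IsTC.sub {A B : H →L[ℂ] K} (hA : IsTC A) (hB : IsTC B) : IsTC (A - B) := by
  simpa [sub_eq_add_neg] using hA.add (hB.smul (-1))

theorem isTC_rankOne (y : K) (z : H) : IsTC (rankOne y z) := by
  refine ⟨fun n => if n = 0 then y else 0, fun n => if n = 0 then z else 0, ?_, fun x => ?_⟩
  · exact summable_of_ne_finset_zero (s := {0}) fun n hn => by simp_all
  · convert! hasSum_single (f := fun n : ℕ => ⟪(if n = 0 then z else 0 : H), x⟫ •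
      (if n = 0 then y else 0 : K)) 0 (fun n hn => by simp [hn]) using 1

section Trace

variable {ι : Type*} (e : HilbertBasis ι ℂ H)

theorem hasSum_norm_inner_sq (x : H) : HasSum (fun i => ‖⟪e i, x⟫‖ ^ 2) (‖x‖ ^ 2) := by
  have h := Complex.hasSum_re (e.hasSum_inner_mul_inner x x)
  convert! h using 1
  · ext i
    rw [← inner_conj_symm x (e i), ← Complex.normSq_eq_conj_mul_self, Complex.ofReal_re,
      Complex.normSq_eq_norm_sq]
  · rw [inner_self_eq_norm_sq_to_K]
    norm_cast

theorem IsSqRep.trC_eq {A : H →L[ℂ] H} {f g : ℕ → H} (h : IsSqRep A f g) :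
    trC e A = ∑' n, ⟪g n, f n⟫ := by
  have key : ∀ n, Summable (fun i => ‖⟪g n, e i⟫ * ⟪e i, f n⟫‖) ∧
      ∑' i, ‖⟪g n, e i⟫ * ⟪e i, f n⟫‖ ≤ (‖g n‖ ^ 2 + ‖f n‖ ^ 2) / 2 := by
    intro n
    have h1 := ((hasSum_norm_inner_sq e (g n)).add (hasSum_norm_inner_sq e (f n))).div_const 2
    have h2 : ∀ i, ‖⟪g n, e i⟫ * ⟪e i, f n⟫‖ ≤ (‖⟪e i, g n⟫‖ ^ 2 + ‖⟪e i, f n⟫‖ ^ 2) / 2 := by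
      intro i
      rw [norm_mul, norm_inner_symm (g n)]
      nlinarith [sq_nonneg (‖⟪e i, g n⟫‖ - ‖⟪e i, f n⟫‖)]
    have h3 := Summable.of_nonneg_of_le (fun i => norm_nonneg _) h2 h1.summable
    exact ⟨h3, (h3.tsum_le_tsum h2 h1.summable).trans h1.tsum_eq.le⟩
  have hsum : Summable (Function.uncurry fun (n : ℕ) (i : ι) => ⟪g n, e i⟫ * ⟪e i, f n⟫) := by
    refine Summable.of_norm ?_
    refine (summable_prod_of_nonneg fun _ => norm_nonneg _).2 ⟨fun n => (key n).1, ?_⟩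
    exact Summable.of_nonneg_of_le (fun n => tsum_nonneg fun i => norm_nonneg _)
      (fun n => (key n).2) ((h.2.1.add h.1).div_const 2)
  calc trC e A = ∑' i, ∑' n, ⟪g n, e i⟫ * ⟪e i, f n⟫ := by
        refine tsum_congr fun i => ?_
        have := (h.2.2 (e i)).mapL (innerSL ℂ (e i))
        simp only [innerSL_apply_apply, inner_smul_right] at this
        exact this.tsum_eq.symm
    _ = ∑' n, ∑' i, ⟪g n, e i⟫ * ⟪e i, f n⟫ := hsum.tsum_comm
    _ = _ := tsum_congr fun n => e.tsum_inner_mul_inner _ _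

theorem trC_smul (c : ℂ) (A : H →L[ℂ] H) : trC e (c • A) = c * trC e A := by
  simp [trC, tsum_mul_left]

theorem trC_rankOne_comp [CompleteSpace H] (y z : H) (A : H →L[ℂ] H) : trC e (rankOne y z ∘L A) = ⟪z, A y⟫ := by
  simp only [trC, coe_comp, Function.comp_apply, rankOne_apply, inner_smul_right,
    ← adjoint_inner_left A]
  exact e.tsum_inner_mul_inner _ _

theorem IsTC.bddAbove {A : H →L[ℂ] H} (hA : IsTC A) :
    BddAbove { r : ℝ | ∃ B : H →L[ℂ] H, ‖B‖ ≤ 1 ∧ r = ‖trC e (B ∘L A)‖ } := by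
  obtain ⟨f, g, h⟩ := hA.exists_isSqRep
  refine ⟨∑' n, ‖f n‖ * ‖g n‖, ?_⟩
  rintro _ ⟨B, hB, rfl⟩
  rw [(h.comp B).trC_eq]
  refine tsum_of_norm_bounded h.summable_mul.hasSum fun n => ?_
  refine (norm_inner_le_norm _ _).trans ?_
  rw [mul_comm]
  gcongr
  exact B.le_of_opNorm_le_of_le hB le_rfl |>.trans_eq (one_mul _)

theorem IsTC.norm_le_tnorm [CompleteSpace H] {A : H →L[ℂ] H} (hA : IsTC A) : ‖A‖ ≤ tnorm e A := by
  have h0 : 0 ≤ tnorm e A := Real.sSup_nonneg (by rintro _ ⟨B, -, rfl⟩; positivity)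
  refine opNorm_le_of_re_inner_le h0 fun x y hx hy => ?_
  refine (Complex.re_le_norm _).trans ?_
  rw [norm_inner_symm, ← trC_rankOne_comp e]
  exact le_csSup (hA.bddAbove e) ⟨_, by rw [norm_rankOne, hx, hy, one_mul], rfl⟩

end Trace

/-- The positive operator `∑ |h n⟩⟨h n|` of a square-summable sequence. -/
theorem exists_isSqRep_self [CompleteSpace H] {h : ℕ → H} (hh : Summable fun n => ‖h n‖ ^ 2) :
    ∃ P : H →L[ℂ] H, P.IsPositive ∧ IsSqRep P h h := by
  have hs : Summable fun n => rankOne (h n) (h n) :=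
    Summable.of_norm (by simpa [norm_rankOne, ← sq] using hh)
  have hP : IsSqRep (∑' n, rankOne (h n) (h n)) h h := by
    refine ⟨hh, hh, fun x => ?_⟩
    simpa [rankOne_apply] using hs.hasSum.mapL (ContinuousLinearMap.apply ℂ H x)
  refine ⟨_, (ContinuousLinearMap.isPositive_iff_complex _).2 fun x => ?_, hP⟩
  set P := ∑' n, rankOne (h n) (h n)
  have h1 : HasSum (fun n => ((‖⟪h n, x⟫‖ ^ 2 : ℝ) : ℂ)) ⟪x, P x⟫ := by
    convert! (hP.2.2 x).mapL (innerSL ℂ x) using 2 with n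
    rw [innerSL_apply_apply, inner_smul_right, ← inner_conj_symm x (h n), Complex.mul_conj,
      Complex.normSq_eq_norm_sq]
  have h2 : ⟪x, P x⟫ = ((∑' n, ‖⟪h n, x⟫‖ ^ 2 : ℝ) : ℂ) := by
    rw [← h1.tsum_eq, Complex.ofReal_tsum]
  have h3 : ⟪P x, x⟫ = ((∑' n, ‖⟪h n, x⟫‖ ^ 2 : ℝ) : ℂ) := by
    rw [← inner_conj_symm, h2, Complex.conj_ofReal]
  rw [h3]
  exact ⟨by simp, by simpa using tsum_nonneg fun n => by positivity⟩

theorem exists_smul_isState {ι : Type*} (e : HilbertBasis ι ℂ H) {h : ℕ → H} {P : H →L[ℂ] H}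
    (hP : P.IsPositive) (hr : IsSqRep P h h) :
    P = 0 ∨ ∃ (c : ℂ) (ρ : H →L[ℂ] H), IsState e ρ ∧ P = c • ρ := by
  have htr : trC e P = ((∑' n, ‖h n‖ ^ 2 : ℝ) : ℂ) := by
    rw [hr.trC_eq, Complex.ofReal_tsum]
    refine tsum_congr fun n => ?_
    rw [inner_self_eq_norm_sq_to_K]
    norm_cast
  set t := ∑' n, ‖h n‖ ^ 2
  have ht : 0 ≤ t := tsum_nonneg fun n => by positivity
  rcases ht.eq_or_lt with h0 | h0
  · left
    have hz : ∀ n, h n = 0 := fun n => by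
      have := hr.1.le_tsum n fun m _ => by positivity
      have h2 : ‖h n‖ ^ 2 = 0 := le_antisymm (this.trans h0.ge) (by positivity)
      simpa using h2
    ext x
    have := hr.2.2 x
    simp only [hz, smul_zero] at this
    simpa using this.unique hasSum_zero
  · right
    have htc : (t : ℂ) ≠ 0 := by exact_mod_cast h0.ne'
    refine ⟨t, ((t⁻¹ : ℝ) : ℂ) • P, ⟨?_, hr.isTC.smul _, ?_⟩, ?_⟩
    · exact hP.smul_of_nonneg (by exact_mod_cast inv_nonneg.2 ht)
    · rw [trC_smul, htr]
      push_cast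
      exact inv_mul_cancel₀ htc
    · rw [smul_smul]
      push_cast
      rw [mul_inv_cancel₀ htc, one_smul]

/-- Trace-class operators are linear combinations of states. -/
theorem IsTC.induction [CompleteSpace H] {ι : Type*} (e : HilbertBasis ι ℂ H)
    {p : (H →L[ℂ] H) → Prop}
    (zero : p 0) (state : ∀ ρ, IsState e ρ → p ρ)
    (add : ∀ ρ σ, IsTC ρ → IsTC σ → p ρ → p σ → p (ρ + σ))
    (smul : ∀ (c : ℂ) ρ, IsTC ρ → p ρ → p (c • ρ)) {A : H →L[ℂ] H} (hA : IsTC A) : p A := by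
  obtain ⟨f, g, hf, hg, hA⟩ := hA.exists_isSqRep
  have hsum : ∀ u : ℂ, Summable fun n => ‖f n + u • g n‖ ^ 2 := fun u => by
    refine Summable.of_nonneg_of_le (fun n => by positivity) (fun n => ?_)
      ((hf.mul_left 2).add (hg.mul_left (2 * ‖u‖ ^ 2)))
    have h1 : ‖f n + u • g n‖ ^ 2 ≤ (‖f n‖ + ‖u‖ * ‖g n‖) ^ 2 := by
      gcongr
      exact (norm_add_le _ _).trans_eq (by rw [norm_smul])
    nlinarith [sq_nonneg (‖f n‖ - ‖u‖ * ‖g n‖)]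
  choose P hP hr using fun u => exists_isSqRep_self (hsum u)
  have hp : ∀ u, p (P u) := fun u => by
    rcases exists_smul_isState e (hP u) (hr u) with h0 | ⟨c, ρ, hρ, hc⟩
    · rwa [h0]
    · rw [hc]
      exact smul c ρ hρ.2.1 (state ρ hρ)
  have htc := fun u => (hr u).isTC
  have hdec : A = (1 / 4 : ℂ) • ((P 1 + (-1 : ℂ) • P (-1)) +
      (Complex.I • P Complex.I + (-Complex.I) • P (-Complex.I))) := by
    ext x
    refine (hA x).unique ?_
    have h4 := ((((hr 1).2.2 x).add (((hr (-1)).2.2 x).const_smul (-1 : ℂ))).add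
      ((((hr Complex.I).2.2 x).const_smul Complex.I).add
        (((hr (-Complex.I)).2.2 x).const_smul (-Complex.I)))).const_smul (1 / 4 : ℂ)
    convert! h4 using 1
    ext n
    simp only [inner_add_left, inner_smul_left, map_neg, map_one, Complex.conj_I]
    match_scalars
    · linear_combination (1 / 2 * ⟪g n, x⟫) * Complex.I_sq
    · linear_combination (-1 / 2 * ⟪f n, x⟫) * Complex.I_sq
  rw [hdec]
  exact smul _ _ (((htc _).add ((htc _).smul _)).add (((htc _).smul _).add ((htc _).smul _)))
    (add _ _ ((htc _).add ((htc _).smul _)) (((htc _).smul _).add ((htc _).smul _))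
      (add _ _ (htc _) ((htc _).smul _) (hp _) (smul _ _ (htc _) (hp _)))
      (add _ _ ((htc _).smul _) ((htc _).smul _) (smul _ _ (htc _) (hp _))
        (smul _ _ (htc _) (hp _))))

/-- Conjugation of a trace-class operator is weakly continuous along bounded strongly convergent
sequences. -/
theorem tendsto_inner_conj [CompleteSpace H] [CompleteSpace K] {W : ℕ → H →L[ℂ] K}
    {W₀ : H →L[ℂ] K} (hW : ∀ n, ‖W n‖ ≤ 1)
    (h : SOTConv W W₀) {ρ : H →L[ℂ] H} (hρ : IsTC ρ) (x y : K) :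
    Tendsto (fun n => ⟪x, (W n ∘L ρ ∘L adjoint (W n)) y⟫) atTop
      (𝓝 ⟪x, (W₀ ∘L ρ ∘L adjoint W₀) y⟫) := by
  obtain ⟨f, g, hs, hr⟩ := hρ
  have hval : ∀ T : H →L[ℂ] K,
      ⟪x, (T ∘L ρ ∘L adjoint T) y⟫ = ∑' m, ⟪T (g m), y⟫ * ⟪x, T (f m)⟫ := by
    intro T
    have := ((hr (adjoint T y)).mapL T).mapL (innerSL ℂ x)
    simp only [map_smul, innerSL_apply_apply, adjoint_inner_right, smul_eq_mul] at this
    exact this.tsum_eq.symm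
  simp only [hval]
  refine tendsto_tsum_of_dominated_convergence (hs.mul_left (‖x‖ * ‖y‖))
    (fun m => ((h (g m)).inner tendsto_const_nhds).mul (tendsto_const_nhds.inner (h (f m))))
    (Eventually.of_forall fun n m => ?_)
  have hle : ∀ z, ‖W n z‖ ≤ ‖z‖ := fun z =>
    ((W n).le_of_opNorm_le (hW n) z).trans_eq (one_mul _)
  calc ‖⟪W n (g m), y⟫ * ⟪x, W n (f m)⟫‖
      ≤ (‖g m‖ * ‖y‖) * (‖x‖ * ‖f m‖) := by
        rw [norm_mul]
        gcongr
        · exact (norm_inner_le_norm _ _).trans (by gcongr; exact hle _)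
        · exact (norm_inner_le_norm _ _).trans (by gcongr; exact hle _)
    _ = _ := by ring

/-- If the operators `|V n x⟩⟨V n y|` all converge strongly, then a subsequence of `V` converges
pointwise. -/
theorem exists_subseq_tendsto_of_rankOne {V : ℕ → H →L[ℂ] K} (hV : ∀ n, ‖V n‖ ≤ 1)
    {Ψ : H → H → K →L[ℂ] K}
    (h : ∀ x y, Tendsto (fun n => rankOne (V n x) (V n y)) atTop (𝓝 (Ψ x y))) :
    ∃ k : ℕ → ℕ, StrictMono k ∧ ∀ x, ∃ y, Tendsto (fun j => V (k j) x) atTop (𝓝 y) := by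
  have hle : ∀ n z, ‖V n z‖ ≤ ‖z‖ := fun n z =>
    ((V n).le_of_opNorm_le (hV n) z).trans_eq (one_mul _)
  by_cases hne : ∃ x v, Ψ x x v ≠ 0
  · obtain ⟨x₀, v, hv⟩ := hne
    have hlim : ∀ x, Tendsto (fun n => ⟪V n x₀, v⟫ • V n x) atTop (𝓝 (Ψ x x₀ v)) := fun x => by
      simpa [rankOne_apply, Function.comp_def] using
        ((ContinuousLinearMap.apply ℂ K v).continuous.tendsto _).comp (h x x₀)
    obtain ⟨c, -, k, hk, hc⟩ := tendsto_subseq_of_bounded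
      (Metric.isBounded_closedBall (x := (0 : ℂ)) (r := ‖x₀‖ * ‖v‖))
      (x := fun n => ⟪V n x₀, v⟫) fun n => by
        rw [mem_closedBall_zero_iff]
        exact (norm_inner_le_norm _ _).trans (by gcongr; exact hle _ _)
    have hc0 : c ≠ 0 := by
      rintro rfl
      refine hv (tendsto_nhds_unique ((hlim x₀).comp hk.tendsto_atTop) ?_)
      refine squeeze_zero_norm (a := fun j => ‖⟪V (k j) x₀, v⟫‖ * ‖x₀‖) (fun j => ?_) ?_
      · simp only [Function.comp_apply, norm_smul]
        gcongr
        exact hle _ _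
      · simpa using hc.norm.mul_const ‖x₀‖
    refine ⟨k, hk, fun x => ⟨c⁻¹ • Ψ x x₀ v, ?_⟩⟩
    refine ((hc.inv₀ hc0).smul ((hlim x).comp hk.tendsto_atTop)).congr' ?_
    filter_upwards [hc.eventually_ne hc0] with j hj
    simp only [Function.comp_apply] at hj ⊢
    rw [inv_smul_smul₀ hj]
  · push Not at hne
    refine ⟨id, strictMono_id, fun x => ⟨0, ?_⟩⟩
    have hΨ : Ψ x x = 0 := by
      ext v
      simpa using hne x v
    have h1 := (h x x).norm
    simp only [norm_rankOne, hΨ, norm_zero] at h1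
    have h2 := h1.sqrt
    simp only [Real.sqrt_mul_self (norm_nonneg _), Real.sqrt_zero] at h2
    exact tendsto_zero_iff_norm_tendsto_zero.2 h2

end RankOneKraus

section Statement

variable {HA HB : Type*} [NormedAddCommGroup HA] [InnerProductSpace ℂ HA] [CompleteSpace HA]
  [NormedAddCommGroup HB] [InnerProductSpace ℂ HB] [CompleteSpace HB]

/-- If the quantum operations `ρ ↦ V_n ρ V_n*` induced by contractions `V_n` converge strongly
to a quantum operation `Φ₀`, then some subsequence `{V_{n_k}}` converges in the strong operator
topology to a contraction `V₀` with `Φ₀(ρ) = V₀ ρ V₀*` for all trace-class `ρ`. -/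
theorem rank_one_Kraus_limit
    (eA : HilbertBasis ℕ ℂ HA) (eB : HilbertBasis ℕ ℂ HB)
    (V : ℕ → HA →L[ℂ] HB) (hV : ∀ n, ‖V n‖ ≤ 1)
    (Φ₀ : QOp eA eB)
    (hconv : ∀ ρ : HA →L[ℂ] HA, IsState eA ρ →
      Tendsto (fun n =>
        tnorm eB (V n ∘L ρ ∘L ContinuousLinearMap.adjoint (V n) - Φ₀.toFun ρ))
        atTop (nhds 0)) :
    ∃ (k : ℕ → ℕ) (V₀ : HA →L[ℂ] HB), StrictMono k ∧ ‖V₀‖ ≤ 1 ∧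
      SOTConv (fun j => V (k j)) V₀ ∧
      ∀ ρ : HA →L[ℂ] HA, IsTC ρ →
        Φ₀.toFun ρ = V₀ ∘L ρ ∘L ContinuousLinearMap.adjoint V₀ := by
  have key : ∀ ρ : HA →L[ℂ] HA, IsTC ρ →
      Tendsto (fun n => V n ∘L ρ ∘L adjoint (V n)) atTop (𝓝 (Φ₀.toFun ρ)) := by
    intro ρ hρ
    refine IsTC.induction eA (p := fun ρ => Tendsto (fun n => V n ∘L ρ ∘L adjoint (V n)) atTop
      (𝓝 (Φ₀.toFun ρ))) ?_ (fun ρ hρ => ?_) (fun ρ σ hρ hσ h1 h2 => ?_) (fun c ρ hρ h1 => ?_) hρ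
    · have h0 : Φ₀.toFun 0 = 0 := by
        simpa using Φ₀.map_smul' 0 _ (isTC_rankOne (0 : HA) (0 : HA))
      simp [h0]
    · rw [tendsto_iff_norm_sub_tendsto_zero]
      refine squeeze_zero (fun n => norm_nonneg _) (fun n => ?_) (hconv ρ hρ)
      exact (((hρ.2.1.comp_adjoint (V n)).comp_left (V n)).sub
        (Φ₀.maps_tc' ρ hρ.2.1)).norm_le_tnorm eB
    · rw [Φ₀.map_add' ρ σ hρ hσ]
      simpa [add_comp, comp_add] using h1.add h2
    · rw [Φ₀.map_smul' c ρ hρ]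
      simpa [smul_comp, comp_smul] using h1.const_smul c
  obtain ⟨k, hk, hlim⟩ := exists_subseq_tendsto_of_rankOne hV
    (Ψ := fun x y => Φ₀.toFun (rankOne x y)) fun x y => by
      simpa only [comp_rankOne_comp_adjoint] using key _ (isTC_rankOne x y)
  choose F hF using hlim
  let V₀ : HA →L[ℂ] HB :=
    continuousLinearMapOfTendsto (fun j => V (k j)) (tendsto_pi_nhds.2 hF)
  have hV₀ : SOTConv (fun j => V (k j)) V₀ := hF
  refine ⟨k, V₀, hk, opNorm_le_bound _ zero_le_one fun x => ?_, hV₀, fun ρ hρ => ?_⟩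
  · exact le_of_tendsto (hV₀ x).norm
      (Eventually.of_forall fun j => (V (k j)).le_of_opNorm_le (hV _) x)
  · ext y
    refine ext_inner_left ℂ fun x => ?_
    refine tendsto_nhds_unique ?_ (tendsto_inner_conj (fun j => hV (k j)) hV₀ hρ x y)
    exact tendsto_const_nhds.inner
      (((ContinuousLinearMap.apply ℂ HB y).continuous.tendsto _).comp
        ((key ρ hρ).comp hk.tendsto_atTop))

end Statement
end
end
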